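/- For x = (x₁, x₂) ∈ ℝ², let (π(x)u)(t) = exp(πi·x₁x₂)·exp(2πi·t·x₂)·u(t + x₁) on 𝒮(ℝ, ℂ). Given g ∈ 𝒮(ℝ², ℂ), define k(t, s) = ∫_ℝ g(s − t, ξ)·exp(πi(s − t)ξ)·exp(2πi·t·ξ) dξ. Then k is a Schwartz function on ℝ², and for every u ∈ 𝒮(ℝ, ℂ) and every t ∈ ℝ, ∫_{ℝ²} g(x₁, x₂)·(π(x)u)(t) dx = ∫_ℝ k(t, s)·u(s) ds; that is, the integrated operator π(g) = ∫_{ℝ²} g(x)π(x) dx is an integral operator with Schwartz kernel k. -/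

import Mathlib

open Complex MeasureTheory

/-- The Heisenberg representation of `ℝ × ℝ^` on functions on `ℝ`:
`(π(x)u)(t) = exp(πi x₁x₂) exp(2πi t x₂) u(t + x₁)`. -/
noncomputable def heisRep (x : ℝ × ℝ) (u : ℝ → ℂ) : ℝ → ℂ :=
  fun t => Complex.exp ((Real.pi : ℂ) * Complex.I * (x.1 : ℂ) * (x.2 : ℂ)) *
    Complex.exp (2 * (Real.pi : ℂ) * Complex.I * (t : ℂ) * (x.2 : ℂ)) * u (t + x.1)

open scoped SchwartzMap FourierTransform

section PartialFourier

variable {E : Type} [NormedAddCommGroup E] [NormedSpace ℂ E]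

/-- The Fourier transform of `g` in its second variable. -/
noncomputable def partialFourier (g : 𝓢(ℝ × ℝ, E)) (p : ℝ × ℝ) : E :=
  ∫ ξ : ℝ, Complex.exp (-(2 * Real.pi * Complex.I * p.2 * ξ)) • g (p.1, ξ)

theorem norm_exp_phase (b ξ : ℝ) :
    ‖Complex.exp (-(2 * Real.pi * Complex.I * b * ξ))‖ = 1 := by
  have : -(2 * Real.pi * Complex.I * b * ξ) = ((-(2 * Real.pi * b * ξ) : ℝ) : ℂ) * Complex.I := by
    push_cast; ring
  rw [this, Complex.norm_exp_ofReal_mul_I]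

theorem partialFourier_eq_fourier (g : 𝓢(ℝ × ℝ, E)) (p : ℝ × ℝ) :
    partialFourier g p = 𝓕 (fun ξ : ℝ => g (p.1, ξ)) p.2 := by
  rw [Real.fourier_real_eq_integral_exp_smul, partialFourier]
  congr 1 with ξ
  congr 2
  push_cast
  ring

theorem SchwartzMap.exists_norm_slice_le (g : 𝓢(ℝ × ℝ, E)) :
    ∃ C : ℝ, ∀ a ξ : ℝ, ‖g (a, ξ)‖ ≤ C * (1 + ξ ^ 2)⁻¹ := by
  refine ⟨SchwartzMap.seminorm ℝ 0 0 g + SchwartzMap.seminorm ℝ 2 0 g, fun a ξ => ?_⟩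
  rw [← div_eq_mul_inv, le_div_iff₀ (by positivity)]
  have h0 := SchwartzMap.norm_le_seminorm ℝ g (a, ξ)
  have h2 := SchwartzMap.norm_pow_mul_le_seminorm ℝ g 2 (a, ξ)
  have h3 : ξ ^ 2 ≤ ‖(a, ξ)‖ ^ 2 := by
    rw [← sq_abs ξ]
    exact pow_le_pow_left₀ (abs_nonneg _) (norm_snd_le (a, ξ)) 2
  nlinarith [mul_le_mul_of_nonneg_right h3 (norm_nonneg (g (a, ξ)))]

theorem SchwartzMap.integrable_slice (g : 𝓢(ℝ × ℝ, E)) (a : ℝ) :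
    Integrable (fun ξ : ℝ => g (a, ξ)) := by
  obtain ⟨C, hC⟩ := g.exists_norm_slice_le
  refine (integrable_inv_one_add_sq.const_mul C).mono' ?_ (.of_forall (hC a))
  exact (g.continuous.comp (by fun_prop)).aestronglyMeasurable

theorem exists_norm_partialFourier_le (g : 𝓢(ℝ × ℝ, E)) :
    ∃ C : ℝ, ∀ p, ‖partialFourier g p‖ ≤ C := by
  obtain ⟨C, hC⟩ := g.exists_norm_slice_le
  refine ⟨∫ ξ : ℝ, C * (1 + ξ ^ 2)⁻¹, fun p => ?_⟩
  refine norm_integral_le_of_norm_le (integrable_inv_one_add_sq.const_mul C) (.of_forall fun ξ => ?_)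
  rw [norm_smul, norm_exp_phase, one_mul]
  exact hC _ _

/-- The Schwartz function whose partial Fourier transform is the derivative of that of `g`. -/
noncomputable def partialFourierSymbol (g : 𝓢(ℝ × ℝ, E)) : 𝓢(ℝ × ℝ, ℝ × ℝ →L[ℝ] E) :=
  (SchwartzMap.fderivCLM ℝ (ℝ × ℝ) E g).postcompCLM
      ((ContinuousLinearMap.compL ℝ (ℝ × ℝ) (ℝ × ℝ) E).flip
        (ContinuousLinearMap.inl ℝ ℝ ℝ ∘L ContinuousLinearMap.fst ℝ ℝ ℝ)) +
    SchwartzMap.smulRightCLM ℝ E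
      ((ContinuousLinearMap.snd ℝ ℝ ℝ).smulRight (ContinuousLinearMap.snd ℝ ℝ ℝ))
      ((-(2 * Real.pi * Complex.I) : ℂ) • g)

theorem hasFDerivAt_exp_smul_slice (g : 𝓢(ℝ × ℝ, E)) (ξ : ℝ) (p : ℝ × ℝ) :
    HasFDerivAt (fun p : ℝ × ℝ => Complex.exp (-(2 * Real.pi * Complex.I * p.2 * ξ)) • g (p.1, ξ))
      (Complex.exp (-(2 * Real.pi * Complex.I * p.2 * ξ)) • partialFourierSymbol g (p.1, ξ)) p := by
  have h2 : HasFDerivAt (fun p : ℝ × ℝ => (p.2 : ℂ))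
      (Complex.ofRealCLM ∘L ContinuousLinearMap.snd ℝ ℝ ℝ) p :=
    (Complex.ofRealCLM ∘L ContinuousLinearMap.snd ℝ ℝ ℝ).hasFDerivAt
  have hc := (((h2.const_mul (2 * Real.pi * Complex.I)).mul_const (ξ : ℂ)).neg).cexp
  have hl : HasFDerivAt (fun p : ℝ × ℝ => (p.1, ξ))
      (ContinuousLinearMap.inl ℝ ℝ ℝ ∘L ContinuousLinearMap.fst ℝ ℝ ℝ) p := by
    convert! (hasFDerivAt_fst (𝕜 := ℝ) (p := p)).prodMk (hasFDerivAt_const ξ p) using 1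
  have hg := (g.hasFDerivAt (p.1, ξ)).comp p hl
  convert! hc.smul hg using 1
  refine ContinuousLinearMap.ext fun v => ?_
  simp [partialFourierSymbol, smul_smul]
  module

theorem hasFDerivAt_partialFourier (g : 𝓢(ℝ × ℝ, E)) (p : ℝ × ℝ) :
    HasFDerivAt (partialFourier g) (partialFourier (partialFourierSymbol g) p) p := by
  obtain ⟨C, hC⟩ := (partialFourierSymbol g).exists_norm_slice_le
  have hmeas {F : Type} [NormedAddCommGroup F] [NormedSpace ℂ F] (h : 𝓢(ℝ × ℝ, F)) (q : ℝ × ℝ) :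
      AEStronglyMeasurable
        (fun ξ : ℝ => Complex.exp (-(2 * Real.pi * Complex.I * q.2 * ξ)) • h (q.1, ξ)) := by
    have : Continuous fun ξ : ℝ => h (q.1, ξ) := h.continuous.comp (by fun_prop)
    exact Continuous.aestronglyMeasurable (by fun_prop)
  refine hasFDerivAt_integral_of_dominated_of_fderiv_le (𝕜 := ℝ) (s := Set.univ)
    (bound := fun ξ => C * (1 + ξ ^ 2)⁻¹) Filter.univ_mem (.of_forall (hmeas g)) ?_ (hmeas _ p) ?_
    (integrable_inv_one_add_sq.const_mul C)
    (.of_forall fun ξ q _ => hasFDerivAt_exp_smul_slice g ξ q)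
  · refine (g.integrable_slice p.1).norm.mono' (hmeas g p) (.of_forall fun ξ => ?_)
    rw [norm_smul, norm_exp_phase, one_mul]
  · refine .of_forall fun ξ q _ => ?_
    rw [norm_smul, norm_exp_phase, one_mul]
    exact hC _ _

theorem fderiv_partialFourier (g : 𝓢(ℝ × ℝ, E)) :
    fderiv ℝ (partialFourier g) = partialFourier (partialFourierSymbol g) :=
  funext fun p => (hasFDerivAt_partialFourier g p).fderiv

theorem exists_fst_smul_partialFourier (g : 𝓢(ℝ × ℝ, E)) :
    ∃ h : 𝓢(ℝ × ℝ, E), ∀ p, partialFourier h p = p.1 • partialFourier g p := by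
  refine ⟨SchwartzMap.smulLeftCLM E (fun p : ℝ × ℝ => p.1) g, fun p => ?_⟩
  have hfst : (fun p : ℝ × ℝ => p.1).HasTemperateGrowth :=
    (ContinuousLinearMap.fst ℝ ℝ ℝ).hasTemperateGrowth
  simp only [partialFourier, SchwartzMap.smulLeftCLM_apply_apply hfst]
  rw [← integral_smul]
  congr 1 with ξ
  rw [smul_comm]

theorem exists_snd_smul_partialFourier (g : 𝓢(ℝ × ℝ, E)) :
    ∃ h : 𝓢(ℝ × ℝ, E), ∀ p,
      partialFourier h p = (2 * Real.pi * Complex.I * p.2 : ℂ) • partialFourier g p := by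
  let h : 𝓢(ℝ × ℝ, E) := (SchwartzMap.fderivCLM ℝ (ℝ × ℝ) E g).postcompCLM
    (ContinuousLinearMap.apply ℝ E ((0, 1) : ℝ × ℝ))
  refine ⟨h, fun p => ?_⟩
  have hd (ξ : ℝ) : HasDerivAt (fun ξ : ℝ => g (p.1, ξ)) (h (p.1, ξ)) ξ := by
    have := (g.hasFDerivAt (p.1, ξ)).comp_hasDerivAt ξ
      ((hasDerivAt_const ξ p.1).prodMk (hasDerivAt_id ξ))
    exact this
  have hderiv : deriv (fun ξ : ℝ => g (p.1, ξ)) = fun ξ => h (p.1, ξ) :=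
    funext fun ξ => (hd ξ).deriv
  have key := Real.fourier_deriv (g.integrable_slice p.1) (fun ξ => (hd ξ).differentiableAt)
    (hderiv ▸ h.integrable_slice p.1)
  rw [partialFourier_eq_fourier, partialFourier_eq_fourier, ← hderiv, key]

theorem exists_norm_pow_mul_partialFourier_le (k : ℕ) (g : 𝓢(ℝ × ℝ, E)) :
    ∃ C : ℝ, ∀ p, ‖p‖ ^ k * ‖partialFourier g p‖ ≤ C := by
  induction k generalizing g with
  | zero => simpa using exists_norm_partialFourier_le g
  | succ k ih =>
    obtain ⟨h₁, hh₁⟩ := exists_fst_smul_partialFourier g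
    obtain ⟨h₂, hh₂⟩ := exists_snd_smul_partialFourier g
    obtain ⟨C₁, hC₁⟩ := ih h₁
    obtain ⟨C₂, hC₂⟩ := ih h₂
    refine ⟨C₁ + C₂, fun p => ?_⟩
    have e₁ : ‖partialFourier h₁ p‖ = ‖p.1‖ * ‖partialFourier g p‖ := by rw [hh₁, norm_smul]
    have e₂ : ‖p.2‖ * ‖partialFourier g p‖ ≤ ‖partialFourier h₂ p‖ := by
      rw [hh₂, norm_smul]
      gcongr
      simp only [norm_mul, Complex.norm_I, Complex.norm_real, Complex.norm_ofNat, mul_one]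
      refine le_mul_of_one_le_left (norm_nonneg _) ?_
      rw [Real.norm_of_nonneg Real.pi_nonneg]
      linarith [Real.two_le_pi]
    have hp : ‖p‖ ≤ ‖p.1‖ + ‖p.2‖ := by
      rw [Prod.norm_def]
      exact max_le_add_of_nonneg (norm_nonneg _) (norm_nonneg _)
    calc ‖p‖ ^ (k + 1) * ‖partialFourier g p‖
        = ‖p‖ ^ k * (‖p‖ * ‖partialFourier g p‖) := by ring
      _ ≤ ‖p‖ ^ k * ((‖p.1‖ + ‖p.2‖) * ‖partialFourier g p‖) := by gcongr
      _ = ‖p‖ ^ k * (‖p.1‖ * ‖partialFourier g p‖ + ‖p.2‖ * ‖partialFourier g p‖) := by ring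
      _ ≤ ‖p‖ ^ k * (‖partialFourier h₁ p‖ + ‖partialFourier h₂ p‖) := by
        rw [e₁]; gcongr
      _ ≤ C₁ + C₂ := by
        rw [mul_add]; exact add_le_add (hC₁ p) (hC₂ p)

end PartialFourier

theorem contDiff_partialFourier (n : ℕ) {E : Type} [NormedAddCommGroup E] [NormedSpace ℂ E]
    (g : 𝓢(ℝ × ℝ, E)) : ContDiff ℝ n (partialFourier g) := by
  induction n generalizing E with
  | zero =>
    exact contDiff_zero.2 (continuous_iff_continuousAt.2 fun p =>
      (hasFDerivAt_partialFourier g p).continuousAt)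
  | succ n ih =>
    push_cast
    refine contDiff_succ_iff_fderiv.2
      ⟨fun p => (hasFDerivAt_partialFourier g p).differentiableAt, by simp, ?_⟩
    rw [fderiv_partialFourier]
    exact ih _

theorem exists_norm_pow_mul_iteratedFDeriv_partialFourier_le (k n : ℕ) {E : Type}
    [NormedAddCommGroup E] [NormedSpace ℂ E] (g : 𝓢(ℝ × ℝ, E)) :
    ∃ C : ℝ, ∀ p, ‖p‖ ^ k * ‖iteratedFDeriv ℝ n (partialFourier g) p‖ ≤ C := by
  induction n generalizing E with
  | zero => simpa using exists_norm_pow_mul_partialFourier_le k g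
  | succ n ih =>
    simp_rw [← norm_iteratedFDeriv_fderiv, fderiv_partialFourier]
    exact ih _

/-- The partial Fourier transform as a Schwartz function. -/
noncomputable def partialFourierSchwartz {E : Type} [NormedAddCommGroup E] [NormedSpace ℂ E]
    (g : 𝓢(ℝ × ℝ, E)) : 𝓢(ℝ × ℝ, E) where
  toFun := partialFourier g
  smooth' := contDiff_infty.2 fun n => contDiff_partialFourier n g
  decay' k n := exists_norm_pow_mul_iteratedFDeriv_partialFourier_le k n g

/-- The change of variables `(t, s) ↦ (s - t, -(s + t) / 2)`. -/
noncomputable def kernelCoords : (ℝ × ℝ) ≃L[ℝ] (ℝ × ℝ) :=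
  LinearEquiv.toContinuousLinearEquiv
    { toFun := fun p => (p.2 - p.1, -(p.2 + p.1) / 2)
      invFun := fun q => (-q.2 - q.1 / 2, q.1 / 2 - q.2)
      map_add' := fun p q => by ext <;> simp <;> ring
      map_smul' := fun c p => by ext <;> simp <;> ring
      left_inv := fun p => by ext <;> simp <;> ring
      right_inv := fun q => by ext <;> simp; ring }

theorem kernelCoords_apply (t s : ℝ) : kernelCoords (t, s) = (s - t, -(s + t) / 2) := rfl

theorem integrable_mul_heisRep (g : 𝓢(ℝ × ℝ, ℂ)) (u : 𝓢(ℝ, ℂ)) (t : ℝ) :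
    Integrable fun x : ℝ × ℝ => g x * heisRep x u t := by
  have hu : Continuous fun x : ℝ × ℝ => u (t + x.1) := u.continuous.comp (by fun_prop)
  refine g.integrable.mul_bdd (c := SchwartzMap.seminorm ℝ 0 0 u) ?_ (.of_forall fun x => ?_)
  · unfold heisRep
    exact Continuous.aestronglyMeasurable (by fun_prop)
  · have h₁ : (Real.pi : ℂ) * Complex.I * x.1 * x.2 =
        ((Real.pi * x.1 * x.2 : ℝ) : ℂ) * Complex.I := by
      push_cast; ring
    have h₂ : 2 * (Real.pi : ℂ) * Complex.I * t * x.2 =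
        ((2 * Real.pi * t * x.2 : ℝ) : ℂ) * Complex.I := by
      push_cast; ring
    rw [heisRep, norm_mul, norm_mul, h₁, h₂, Complex.norm_exp_ofReal_mul_I,
      Complex.norm_exp_ofReal_mul_I, one_mul, one_mul]
    exact SchwartzMap.norm_le_seminorm ℝ u _

/-- The integrated Heisenberg operator `π(g) = ∫_{ℝ²} g(x) π(x) dx` of a Schwartz
symbol `g` is an integral operator with Schwartz kernel
`k(t,s) = ∫ g(s−t, ξ) exp(πi(s−t)ξ) exp(2πi t ξ) dξ`. -/
theorem heisenberg_integrated_is_integral_operator (g : SchwartzMap (ℝ × ℝ) ℂ) :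
    let k : ℝ → ℝ → ℂ := fun t s =>
      ∫ ξ : ℝ, g (s - t, ξ) * Complex.exp ((Real.pi : ℂ) * Complex.I * ((s : ℂ) - t) * (ξ : ℂ)) *
        Complex.exp (2 * (Real.pi : ℂ) * Complex.I * (t : ℂ) * (ξ : ℂ))
    (∃ K : SchwartzMap (ℝ × ℝ) ℂ, ∀ t s : ℝ, K (t, s) = k t s) ∧
    ∀ (u : SchwartzMap ℝ ℂ) (t : ℝ),
      ∫ x : ℝ × ℝ, g x * heisRep x (⇑u) t = ∫ s : ℝ, k t s * u s := by
  intro k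
  refine ⟨⟨SchwartzMap.compCLMOfContinuousLinearEquiv ℝ kernelCoords (partialFourierSchwartz g),
    fun t s => ?_⟩, fun u t => ?_⟩
  · change partialFourier g (kernelCoords (t, s)) = _
    rw [kernelCoords_apply]
    refine integral_congr_ae (.of_forall fun ξ => ?_)
    simp only [smul_eq_mul]
    rw [mul_assoc (g _), ← Complex.exp_add, mul_comm]
    congr 2
    push_cast
    ring
  · rw [Measure.volume_eq_prod, integral_prod _ (integrable_mul_heisRep g u t),
      ← integral_add_left_eq_self (fun s => k t s * u s) t]
    congr 1 with a
    rw [← integral_mul_const]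
    congr 1 with ξ
    simp only [heisRep, add_sub_cancel_left]
    push_cast
    rw [add_sub_cancel_left]
    ring
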